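/- Define the boundary ∂A of a hyperrectangle A = [a,b⟩ as the set of points x ∈ ∏_{j=1}^p [a_j, b_j] such that x_j ∈ {a_j, b_j} ∖ {0,1} for some j. Assume condition (A2): ∫_𝒜 1_{{z ∈ ∂A}} ν(dA) = 0 for every z ∈ [0,1]^p. Then k0 is continuous on [0,1]^p × [0,1]^p; if in addition ∫_𝒜 α_P²(A) ν(dA) < ∞, then k is continuous on [0,1]^p × [0,1]^p. Furthermore, (A2) holds whenever for every j ∈ {1,…,p} the measure ρ_j on (0,1), defined by ρ_j(B) = ∫_𝒜 (δ_{a_j(A)}(B) + δ_{b_j(A)}(B)) ν(dA) where A = [a(A), b(A)⟩, is atomless. -/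

import Mathlib

open MeasureTheory
open scoped ENNReal RealInnerProductSpace

noncomputable section

/-- Points of the unit cube `[0,1]^p`. -/
abbrev Pt (p : ℕ) : Type := Fin p → Set.Icc (0 : ℝ) 1

/-- Hyperrectangles `∏_j [a_j, b_j⟩` of `[0,1]^p`, encoded by the pair of endpoints
`(a, b)` with `0 ≤ a_j < b_j ≤ 1`, viewed as a subtype of `(Fin p → ℝ) × (Fin p → ℝ)`
with the inherited sup metric (which is exactly the metric `ρ`) and its Borel σ-algebra. -/
abbrev HRect (p : ℕ) : Type :=
  {ab : (Fin p → ℝ) × (Fin p → ℝ) // ∀ j, 0 ≤ ab.1 j ∧ ab.1 j < ab.2 j ∧ ab.2 j ≤ 1}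

/-- Membership `z ∈ [a, b⟩`: `a_j ≤ z_j` and (`z_j < b_j`, or `b_j = 1` in which case
`z_j ≤ b_j` holds automatically). -/
def memRect {p : ℕ} (z : Pt p) (A : HRect p) : Prop :=
  ∀ j, A.1.1 j ≤ (z j : ℝ) ∧ ((z j : ℝ) < A.1.2 j ∨ A.1.2 j = 1)

/-- The indicator `1_A(z)`. -/
def ind {p : ℕ} (z : Pt p) (A : HRect p) : ℝ :=
  haveI := Classical.propDecidable (memRect z A)
  if memRect z A then 1 else 0

/-- The kernel `k0(z,z') = ∫ 1_A(z) 1_A(z') ν(dA)`. -/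
def k0 {p : ℕ} (ν : Measure (HRect p)) (z z' : Pt p) : ℝ :=
  ∫ A, ind z A * ind z' A ∂ν

/-- `P(A)`: the measure of the hyperrectangle `A` under the first marginal of `P`. -/
def PA {p : ℕ} (P : Measure (Pt p × ℝ)) (A : HRect p) : ℝ :=
  (P.fst {z | memRect z A}).toReal

/-- `α_P²(A) = 1/P(A)` if `P(A) > 0`, and `1` otherwise. -/
def alphaSq {p : ℕ} (P : Measure (Pt p × ℝ)) (A : HRect p) : ℝ :=
  haveI := Classical.propDecidable (0 < PA P A)
  if 0 < PA P A then 1 / PA P A else 1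

/-- The kernel `k(z,z') = ∫ α_P²(A) 1_A(z) 1_A(z') ν(dA) ∈ [0,∞]`. -/
def kk {p : ℕ} (P : Measure (Pt p × ℝ)) (ν : Measure (HRect p)) (z z' : Pt p) : ℝ≥0∞ :=
  ∫⁻ A, ENNReal.ofReal (alphaSq P A * ind z A * ind z' A) ∂ν


/-- The boundary `∂A` of the hyperrectangle `A = [a,b⟩`: points `x ∈ ∏_j [a_j,b_j]`
such that `x_j ∈ {a_j, b_j} \ {0,1}` for some `j`. -/
def inBoundary {p : ℕ} (z : Pt p) (A : HRect p) : Prop :=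
  (∀ j, A.1.1 j ≤ (z j : ℝ) ∧ (z j : ℝ) ≤ A.1.2 j) ∧
  ∃ j, ((z j : ℝ) = A.1.1 j ∨ (z j : ℝ) = A.1.2 j) ∧ (z j : ℝ) ≠ 0 ∧ (z j : ℝ) ≠ 1

/-- The measure `ρ_j` on `(0,1)`: `ρ_j(B) = ∫ (δ_{a_j(A)}(B) + δ_{b_j(A)}(B)) ν(dA)`
for Borel `B ⊆ (0,1)`. -/
def rhoJ {p : ℕ} (ν : Measure (HRect p)) (j : Fin p) : Measure ℝ :=
  (ν.map fun A : HRect p => A.1.1 j).restrict (Set.Ioo 0 1)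
    + (ν.map fun A : HRect p => A.1.2 j).restrict (Set.Ioo 0 1)

lemma measurable_leftEnd {p : ℕ} (j : Fin p) : Measurable fun A : HRect p => A.1.1 j :=
  (measurable_pi_apply j).comp (measurable_fst.comp measurable_subtype_coe)

lemma measurable_rightEnd {p : ℕ} (j : Fin p) : Measurable fun A : HRect p => A.1.2 j :=
  (measurable_pi_apply j).comp (measurable_snd.comp measurable_subtype_coe)

/-- The incidence relation between points and hyperrectangles is jointly measurable. -/
lemma measurableSet_memRect {p : ℕ} :
    MeasurableSet {q : HRect p × Pt p | memRect q.2 q.1} := by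
  have hz (j : Fin p) : Measurable fun q : HRect p × Pt p => (q.2 j : ℝ) :=
    measurable_subtype_coe.comp ((measurable_pi_apply j).comp measurable_snd)
  have ha (j : Fin p) : Measurable fun q : HRect p × Pt p => q.1.1.1 j :=
    (measurable_leftEnd j).comp measurable_fst
  have hb (j : Fin p) : Measurable fun q : HRect p × Pt p => q.1.1.2 j :=
    (measurable_rightEnd j).comp measurable_fst
  simp only [memRect, Set.ofPred_forall]
  exact MeasurableSet.iInter fun j => (measurableSet_le (ha j) (hz j)).inter
    ((measurableSet_lt (hz j) (hb j)).union (measurableSet_eq_fun (hb j) measurable_const))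

lemma measurable_ind {p : ℕ} (z : Pt p) : Measurable (ind z) := by
  classical
  have h : MeasurableSet {A : HRect p | memRect z A} :=
    measurable_prodMk_right (y := z) measurableSet_memRect
  unfold ind
  exact Measurable.ite h measurable_const measurable_const

lemma measurable_alphaSq {p : ℕ} (P : Measure (Pt p × ℝ)) [IsProbabilityMeasure P] :
    Measurable (alphaSq P) := by
  have h : Measurable (PA P) :=
    (measurable_measure_prodMk_left (ν := P.fst) measurableSet_memRect).ennreal_toReal
  unfold alphaSq
  exact Measurable.ite (measurableSet_lt measurable_const h) (measurable_const.div h)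
    measurable_const

lemma alphaSq_nonneg {p : ℕ} (P : Measure (Pt p × ℝ)) (A : HRect p) : 0 ≤ alphaSq P A := by
  unfold alphaSq
  split_ifs <;> positivity

lemma ind_nonneg {p : ℕ} (z : Pt p) (A : HRect p) : 0 ≤ ind z A := by
  unfold ind
  split_ifs <;> norm_num

lemma ind_le_one {p : ℕ} (z : Pt p) (A : HRect p) : ind z A ≤ 1 := by
  unfold ind
  split_ifs <;> norm_num

/-- Off the boundary of `A`, membership in `A` is locally constant. -/
lemma eventually_memRect_iff {p : ℕ} {z : Pt p} {A : HRect p} (h : ¬ inBoundary z A) :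
    ∀ᶠ y in nhds z, (memRect y A ↔ memRect z A) := by
  have hc (j : Fin p) : Continuous fun y : Pt p => (y j : ℝ) :=
    continuous_subtype_val.comp (continuous_apply j)
  by_cases hm : memRect z A
  · have hbd (j : Fin p) : (z j : ℝ) ≤ A.1.2 j := by
      rcases (hm j).2 with hlt | heq
      · exact hlt.le
      · exact (z j).2.2.trans_eq heq.symm
    have hev : ∀ᶠ y in nhds z, memRect y A := by
      refine Filter.eventually_all.2 fun j => Filter.Eventually.and ?_ ?_
      · rcases (hm j).1.lt_or_eq with hlt | heq
        · filter_upwards [(hc j).continuousAt.eventually (lt_mem_nhds hlt)] with y hy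
          exact le_of_lt hy
        · have hone : (z j : ℝ) ≠ 1 := by
            exact ne_of_lt (heq ▸ (A.2 j).2.1.trans_le (A.2 j).2.2)
          have hzero : (z j : ℝ) = 0 := by
            by_contra h0
            exact h ⟨fun i => ⟨(hm i).1, hbd i⟩, j, Or.inl heq.symm, h0, hone⟩
          exact Filter.Eventually.of_forall fun y => (heq.trans hzero).trans_le (y j).2.1
      · rcases (hm j).2 with hlt | heq
        · filter_upwards [(hc j).continuousAt.eventually (gt_mem_nhds hlt)] with y hy
          exact Or.inl hy
        · exact Filter.Eventually.of_forall fun _ => Or.inr heq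
    filter_upwards [hev] with y hy
    exact iff_of_true hy hm
  · have hev : ∀ᶠ y in nhds z, ¬ memRect y A := by
      obtain ⟨j, hj⟩ := not_forall.1 hm
      rcases lt_or_ge (z j : ℝ) (A.1.1 j) with hlt | hge
      · filter_upwards [(hc j).continuousAt.eventually (gt_mem_nhds hlt)] with y hy hy'
        exact absurd (hy' j).1 (not_le.2 hy)
      have hj' : A.1.2 j ≤ z j ∧ A.1.2 j ≠ 1 := by
        simpa only [hge, true_and, not_or, not_lt] using hj
      by_cases hbox : ∀ i, A.1.1 i ≤ (z i : ℝ) ∧ (z i : ℝ) ≤ A.1.2 i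
      · have heq := le_antisymm (hbox j).2 hj'.1
        have hpos : 0 < A.1.2 j := (A.2 j).1.trans_lt (A.2 j).2.1
        exact absurd ⟨hbox, j, Or.inr heq, heq ▸ hpos.ne', heq ▸ hj'.2⟩ h
      · obtain ⟨i, hi⟩ := not_forall.1 hbox
        rcases not_and_or.1 hi with hlt | hgt
        · filter_upwards [(hc i).continuousAt.eventually (gt_mem_nhds (not_le.1 hlt))] with y hy hy'
          exact absurd (hy' i).1 (not_le.2 hy)
        · filter_upwards [(hc i).continuousAt.eventually (lt_mem_nhds (not_le.1 hgt))] with y hy hy'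
          rcases (hy' i).2 with h1 | h1
          · exact lt_asymm h1 hy
          · exact absurd (y i).2.2 (not_le.2 (h1.symm.trans_lt hy))
    filter_upwards [hev] with y hy
    exact iff_of_false hy hm

lemma continuousAt_ind {p : ℕ} {z : Pt p} {A : HRect p} (h : ¬ inBoundary z A) :
    ContinuousAt (fun y => ind y A) z := by
  refine continuousAt_const.congr (f := fun _ => ind z A) ?_
  filter_upwards [eventually_memRect_iff h] with y hy
  unfold ind
  split_ifs <;> tauto

/-- A kernel with an integrable nonnegative weight is continuous when boundaries are null. -/
lemma continuous_weighted_kernel {p : ℕ} {ν : Measure (HRect p)} {w : HRect p → ℝ}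
    (hw : Integrable w ν) (hw0 : ∀ A, 0 ≤ w A)
    (hbd : ∀ z : Pt p, ν {A : HRect p | inBoundary z A} = 0) :
    Continuous fun zz : Pt p × Pt p => ∫ A, w A * ind zz.1 A * ind zz.2 A ∂ν := by
  refine continuous_iff_continuousAt.2 fun x => continuousAt_of_dominated (bound := w) ?_ ?_ hw ?_
  · exact Filter.Eventually.of_forall fun y =>
      (hw.aestronglyMeasurable.mul (measurable_ind y.1).aestronglyMeasurable).mul
        (measurable_ind y.2).aestronglyMeasurable
  · refine Filter.Eventually.of_forall fun y => Filter.Eventually.of_forall fun A => ?_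
    have h1 := mul_nonneg (hw0 A) (ind_nonneg y.1 A)
    rw [Real.norm_of_nonneg (mul_nonneg h1 (ind_nonneg y.2 A))]
    exact (mul_le_of_le_one_right h1 (ind_le_one y.2 A)).trans
      (mul_le_of_le_one_right (hw0 A) (ind_le_one y.1 A))
  · have hx (z : Pt p) : ∀ᵐ A ∂ν, ¬ inBoundary z A := by
      simpa only [ae_iff, not_not] using hbd z
    filter_upwards [hx x.1, hx x.2] with A h1 h2
    have c1 : ContinuousAt (fun y : Pt p × Pt p => ind y.1 A) x :=
      ContinuousAt.comp (g := fun z => ind z A) (continuousAt_ind h1) continuousAt_fst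
    have c2 : ContinuousAt (fun y : Pt p × Pt p => ind y.2 A) x :=
      ContinuousAt.comp (g := fun z => ind z A) (continuousAt_ind h2) continuousAt_snd
    exact (continuousAt_const.mul c1).mul c2

lemma toReal_kk {p : ℕ} (P : Measure (Pt p × ℝ)) [IsProbabilityMeasure P]
    (ν : Measure (HRect p)) (z z' : Pt p) :
    (kk P ν z z').toReal = ∫ A, alphaSq P A * ind z A * ind z' A ∂ν := by
  refine (integral_eq_lintegral_of_nonneg_ae (Filter.Eventually.of_forall fun A => ?_) ?_).symm
  · exact mul_nonneg (mul_nonneg (alphaSq_nonneg P A) (ind_nonneg z A)) (ind_nonneg z' A)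
  · exact (((measurable_alphaSq P).mul (measurable_ind z)).mul
      (measurable_ind z')).aestronglyMeasurable

/-- Atomless endpoint measures `ρ_j` make boundaries null. -/
lemma measure_inBoundary_eq_zero {p : ℕ} {ν : Measure (HRect p)}
    (hρ : ∀ j : Fin p, ∀ x : ℝ, rhoJ ν j {x} = 0) (z : Pt p) :
    ν {A : HRect p | inBoundary z A} = 0 := by
  have key (j : Fin p) (hz : (z j : ℝ) ∈ Set.Ioo (0 : ℝ) 1) :
      ν {A : HRect p | A.1.1 j = z j} = 0 ∧ ν {A : HRect p | A.1.2 j = z j} = 0 := by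
    have h := hρ j (z j)
    rw [rhoJ, Measure.add_apply, add_eq_zero,
      Measure.restrict_apply (measurableSet_singleton _),
      Measure.restrict_apply (measurableSet_singleton _),
      Set.inter_eq_left.2 (Set.singleton_subset_iff.2 hz),
      Measure.map_apply (measurable_leftEnd j) (measurableSet_singleton _),
      Measure.map_apply (measurable_rightEnd j) (measurableSet_singleton _)] at h
    exact h
  refine measure_mono_null (t := ⋃ j : Fin p, {A : HRect p | (z j : ℝ) ∈ Set.Ioo (0 : ℝ) 1 ∧
    (A.1.1 j = z j ∨ A.1.2 j = z j)}) ?_ (measure_iUnion_null fun j => ?_)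
  · rintro A ⟨-, j, hj, h0, h1⟩
    exact Set.mem_iUnion.2 ⟨j, ⟨(z j).2.1.lt_of_ne' h0, (z j).2.2.lt_of_ne h1⟩,
      hj.imp Eq.symm Eq.symm⟩
  · by_cases hz : (z j : ℝ) ∈ Set.Ioo (0 : ℝ) 1
    · exact measure_mono_null (fun A hA => hA.2) (measure_union_null (key j hz).1 (key j hz).2)
    · simp [hz]

/-- Proposition on continuity: under assumption (A2) the kernel `k0` is
continuous on `[0,1]^p × [0,1]^p`; if moreover `∫ α_P²(A) ν(dA) < ∞` then `k` is
continuous as well; and (A2) holds whenever all the measures `ρ_j` are atomless. -/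
theorem stmt3 {p : ℕ} (ν : Measure (HRect p)) [IsFiniteMeasure ν]
    (hnorm : ∀ z : Pt p, ∫ A, ind z A ∂ν = 1)
    (P : Measure (Pt p × ℝ)) [IsProbabilityMeasure P] :
    ((∀ z : Pt p, ν {A : HRect p | inBoundary z A} = 0) →
      Continuous fun zz : Pt p × Pt p => k0 ν zz.1 zz.2) ∧
    ((∀ z : Pt p, ν {A : HRect p | inBoundary z A} = 0) →
      (∫⁻ A, ENNReal.ofReal (alphaSq P A) ∂ν) < ⊤ →
      Continuous fun zz : Pt p × Pt p => (kk P ν zz.1 zz.2).toReal) ∧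
    ((∀ j : Fin p, ∀ x : ℝ, rhoJ ν j {x} = 0) →
      ∀ z : Pt p, ν {A : HRect p | inBoundary z A} = 0) := by
  refine ⟨fun hbd => ?_, fun hbd hα => ?_, measure_inBoundary_eq_zero⟩
  · simpa only [k0, one_mul] using
      continuous_weighted_kernel (integrable_const (1 : ℝ)) (fun _ => zero_le_one) hbd
  · simp only [toReal_kk]
    refine continuous_weighted_kernel ⟨(measurable_alphaSq P).aestronglyMeasurable, ?_⟩
      (alphaSq_nonneg P) hbd
    exact (hasFiniteIntegral_iff_ofReal (Filter.Eventually.of_forall (alphaSq_nonneg P))).2 hα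

end
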